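/- For all k, m ≥ 1, the Hart–Sharir sequence S_k(m) contains no (not necessarily contiguous) subsequence a b a b a with a ≠ b; that is, S_k(m) avoids ababa. -/

import Mathlib

/-! ### Sequences with special blocks, encoded as token lists

A sequence with special blocks is encoded as a list of tokens: `Tok.sym a` is an
occurrence of the symbol `a`, and `Tok.op` / `Tok.cl` are the opening and closing
parentheses delimiting the special blocks. -/

/-- Tokens of a symbol sequence with special blocks. -/
inductive Tok : Type where
  | sym : ℕ → Tok
  | op : Tok
  | cl : Tok
deriving DecidableEq, Repr

/-- Tokens of an endpoint sequence with special blocks: `L a` / `R a` are the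
left/right endpoint letters of the symbol `a`, and `op`/`cl` delimit blocks. -/
inductive ETok : Type where
  | L : ℕ → ETok
  | R : ℕ → ETok
  | op : ETok
  | cl : ETok
deriving DecidableEq, Repr

/-- Fresh relabeling of the symbols of the `i`-th local copy. -/
def loc (i a : ℕ) : ℕ := 2 * Nat.pair i a

/-- Relabeling of the global symbols. -/
def glob (a : ℕ) : ℕ := 2 * a + 1

/-- The underlying sequence of symbols of a token list (parentheses dropped). -/
def symsOf : List Tok → List ℕ
  | [] => []
  | Tok.sym a :: r => a :: symsOf r
  | _ :: r => symsOf r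

/-- Read a special block: the symbols up to (and excluding) the next closing
parenthesis, together with the remainder of the list after that parenthesis. -/
def takeBlock : List Tok → List ℕ × List Tok
  | [] => ([], [])
  | Tok.cl :: r => ([], r)
  | Tok.sym a :: r => ((takeBlock r).1.cons a, (takeBlock r).2)
  | Tok.op :: r => takeBlock r

theorem takeBlock_len : ∀ l : List Tok, (takeBlock l).2.length ≤ l.length := by
  intro l
  induction l with
  | nil => simp [takeBlock]
  | cons t r ih => cases t <;> simp [takeBlock] <;> omega

/-- Auxiliary function for the shuffle `A • B`: traverse the `i`-th fresh copy of
`A` (relabeling its symbols by `loc i`), inserting the next global symbol of the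
list `ins` (relabeled by `glob`) at the end of each special block and duplicating
the previously last symbol of that block immediately after the block.  The third
argument remembers the (relabeled) last symbol seen. -/
def copyIns (i : ℕ) : List Tok → List ℕ → Option ℕ → List Tok
  | [], _, _ => []
  | Tok.sym a :: r, ins, _ => Tok.sym (loc i a) :: copyIns i r ins (some (loc i a))
  | Tok.op :: r, ins, p => Tok.op :: copyIns i r ins p
  | Tok.cl :: r, b :: ins, some q =>
      Tok.sym (glob b) :: Tok.cl :: Tok.sym q :: copyIns i r ins (some q)
  | Tok.cl :: r, ins, p => Tok.cl :: copyIns i r ins p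

/-- The modified copy `Aᵢ'` of `A` used in the shuffle `A • B`: the symbols of the
`i`-th special block `blk` of `B` are inserted into the special blocks of the copy,
and another copy of the last symbol of `blk` is appended at the very end. -/
def copyA (i : ℕ) (A : List Tok) (blk : List ℕ) : List Tok :=
  copyIns i A blk none ++ (blk.getLast?.elim [] fun a => [Tok.sym (glob a)])

/-- Auxiliary function for the shuffle: traverse `B` (relabeling its symbols by
`glob`), replacing its `i`-th special block by the modified `i`-th copy of `A`. -/
def bulletAux (A : List Tok) : ℕ → List Tok → List Tok
  | _, [] => []
  | i, Tok.op :: r => copyA i A (takeBlock r).1 ++ bulletAux A (i + 1) (takeBlock r).2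
  | i, Tok.sym a :: r => Tok.sym (glob a) :: bulletAux A i r
  | i, Tok.cl :: r => Tok.cl :: bulletAux A i r
termination_by _ l => l.length
decreasing_by
  · exact Nat.lt_succ_of_le (takeBlock_len r)
  · exact Nat.lt_succ_self _
  · exact Nat.lt_succ_self _

/-- The shuffle `A • B` of two sequences with special blocks. -/
def bullet (A B : List Tok) : List Tok := bulletAux A 0 B

/-- Split each special block of length 2 into two special blocks of length 1. -/
def split2 : List Tok → List Tok
  | Tok.op :: Tok.sym a :: Tok.sym b :: Tok.cl :: r =>
      Tok.op :: Tok.sym a :: Tok.cl :: Tok.op :: Tok.sym b :: Tok.cl :: split2 r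
  | t :: r => t :: split2 r
  | [] => []

/-- The Hart–Sharir sequence `S₁(m) = (1 2 ⋯ m) (m−1) ⋯ 2 1 2 ⋯ m`,
with a single special block `(1 2 ⋯ m)`. -/
def S1 (m : ℕ) : List Tok :=
  Tok.op :: ((List.range' 1 m).map Tok.sym) ++ Tok.cl ::
    (((List.range' 1 (m - 1)).reverse.map Tok.sym) ++ ((List.range' 2 (m - 1)).map Tok.sym))

/-- The number of special blocks of a token sequence. -/
def numBlocks (S : List Tok) : ℕ := S.count Tok.op

/-- The Hart–Sharir sequences `S_k(m)`, defined by double recursion: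
`S₁(m)` is the `N`-shaped sequence above; for `k ≥ 2`, `S_k(1)` is `S_{k−1}(2)` with
each special block of length 2 split into two special blocks of length 1; and for
`k, m ≥ 2`, `S_k(m) = S_k(m−1) • S_{k−1}(N)` where `N` is the number of special
blocks of `S_k(m−1)`.  (The value for `k = 0` or `m = 0` is junk.) -/
def HS : ℕ → ℕ → List Tok
  | 0, _ => []
  | 1, m => S1 m
  | _ + 2, 0 => []
  | k + 2, 1 => split2 (HS (k + 1) 2)
  | k + 2, m + 2 => bullet (HS (k + 2) (m + 1)) (HS (k + 1) (numBlocks (HS (k + 2) (m + 1))))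
termination_by k m => (k, m)



/-- The list of special blocks of a token sequence (each block as its list of symbols). -/
def blocksOf : List Tok → List (List ℕ)
  | [] => []
  | Tok.op :: r => (takeBlock r).1 :: blocksOf (takeBlock r).2
  | _ :: r => blocksOf r
termination_by l => l.length
decreasing_by
  · exact Nat.lt_succ_of_le (takeBlock_len r)
  · exact Nat.lt_succ_self _

/-- The rank of a symbol: the position (counting from 1) that its first occurrence
occupies within its special block (`0` if the symbol lies in no special block). -/
def rankOf (S : List Tok) (a : ℕ) : ℕ :=
  match (blocksOf S).find? (fun b => decide (a ∈ b)) with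
  | some b => b.idxOf a + 1
  | none => 0

/-- Two symbols have their first occurrences in the same special block. -/
def SameBlock (S : List Tok) (a b : ℕ) : Prop :=
  ∃ blk ∈ blocksOf S, a ∈ blk ∧ b ∈ blk

/-- The symbol `a` is left-clamped in the sequence `s`: `s` contains the
subsequence `b a b a`, where `b` is the symbol immediately preceding the first
occurrence of `a` in `s`. -/
def LeftClamped (s : List ℕ) (a : ℕ) : Prop :=
  ∃ (u v : List ℕ) (b : ℕ), s = u ++ b :: a :: v ∧ a ∉ u ∧ b ≠ a ∧
    [b, a, b, a].Sublist s

/-- The symbol `a` is right-clamped in the sequence `s`: `s` contains the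
subsequence `a b a b`, where `b` is the symbol immediately following the last
occurrence of `a` in `s`. -/
def RightClamped (s : List ℕ) (a : ℕ) : Prop :=
  ∃ (u v : List ℕ) (b : ℕ), s = u ++ a :: b :: v ∧ a ∉ v ∧ b ≠ a ∧
    [a, b, a, b].Sublist s

/-- Auxiliary function for the endpoint sequence: the first argument collects the
symbols already seen.  The first occurrence of each symbol becomes an `L` letter,
its last occurrence becomes an `R` letter, all other occurrences are deleted, and
parentheses are kept. -/
def EAux : List ℕ → List Tok → List ETok
  | _, [] => []
  | seen, Tok.op :: r => ETok.op :: EAux seen r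
  | seen, Tok.cl :: r => ETok.cl :: EAux seen r
  | seen, Tok.sym a :: r =>
      if a ∈ seen then
        if a ∈ symsOf r then EAux seen r else ETok.R a :: EAux seen r
      else ETok.L a :: EAux (a :: seen) r

/-- The endpoint sequence `E(S)` of a sequence with special blocks. -/
def Efun (S : List Tok) : List ETok := EAux [] S

/-- Read a special block of an endpoint sequence: the labels of the `L` letters up
to the next closing parenthesis, and the remainder of the list after it. -/
def takeBlockE : List ETok → List ℕ × List ETok
  | [] => ([], [])
  | ETok.cl :: r => ([], r)
  | ETok.L a :: r => ((takeBlockE r).1.cons a, (takeBlockE r).2)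
  | _ :: r => takeBlockE r

theorem takeBlockE_len : ∀ l : List ETok, (takeBlockE l).2.length ≤ l.length := by
  intro l
  induction l with
  | nil => simp [takeBlockE]
  | cons t r ih => cases t <;> simp [takeBlockE] <;> omega

/-- Auxiliary function for the endpoint shuffle `A ∘ B`: traverse the `i`-th fresh
copy of `A` (relabeling by `loc i`), inserting the next left-endpoint letter of the
list `ins` (relabeled by `glob`) at the end of each special block. -/
def ecopyIns (i : ℕ) : List ETok → List ℕ → List ETok
  | [], _ => []
  | ETok.L a :: r, ins => ETok.L (loc i a) :: ecopyIns i r ins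
  | ETok.R a :: r, ins => ETok.R (loc i a) :: ecopyIns i r ins
  | ETok.op :: r, ins => ETok.op :: ecopyIns i r ins
  | ETok.cl :: r, b :: ins => ETok.L (glob b) :: ETok.cl :: ecopyIns i r ins
  | ETok.cl :: r, [] => ETok.cl :: ecopyIns i r []

/-- Auxiliary function for the endpoint shuffle: traverse `B` (relabeling by
`glob`), replacing its `i`-th special block by the `i`-th modified copy of `A`. -/
def eshufAux (A : List ETok) : ℕ → List ETok → List ETok
  | _, [] => []
  | i, ETok.op :: r => ecopyIns i A (takeBlockE r).1 ++ eshufAux A (i + 1) (takeBlockE r).2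
  | i, ETok.L a :: r => ETok.L (glob a) :: eshufAux A i r
  | i, ETok.R a :: r => ETok.R (glob a) :: eshufAux A i r
  | i, ETok.cl :: r => ETok.cl :: eshufAux A i r
termination_by _ l => l.length
decreasing_by
  · exact Nat.lt_succ_of_le (takeBlockE_len r)
  · exact Nat.lt_succ_self _
  · exact Nat.lt_succ_self _
  · exact Nat.lt_succ_self _

/-- The endpoint shuffle `A ∘ B` of two endpoint sequences with special blocks. -/
def eshuffle (A B : List ETok) : List ETok := eshufAux A 0 B

/-- The token list is a well-formed sequence with special blocks: a concatenation
of symbols and of parenthesized blocks consisting only of symbols. -/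
inductive Blocked : List Tok → Prop
  | nil : Blocked []
  | sym (a : ℕ) {l : List Tok} : Blocked l → Blocked (Tok.sym a :: l)
  | blk (b : List ℕ) {l : List Tok} :
      Blocked l → Blocked (Tok.op :: b.map Tok.sym ++ Tok.cl :: l)

/-- The special blocks of `S` contain only first occurrences of symbols, and every
symbol of `S` makes its first occurrence inside a special block. -/
def FirstOccBlocks (S : List Tok) : Prop :=
  (∀ (u b v : List Tok), S = u ++ Tok.op :: b ++ Tok.cl :: v →
      ∀ a : ℕ, Tok.sym a ∈ b → a ∉ symsOf u ∧ (symsOf b).count a = 1) ∧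
  (∀ a ∈ symsOf S, ∃ (u b v : List Tok),
      S = u ++ Tok.op :: b ++ Tok.cl :: v ∧ Tok.sym a ∈ b ∧ a ∉ symsOf u)

/-! ### Sequences avoiding `ababa` and their projections -/

/-- The list contains no alternation `a b a b a` of distinct symbols. -/
def AvoidsABABA (l : List ℕ) : Prop :=
  ∀ a b : ℕ, a ≠ b → ¬ [a, b, a, b, a].Sublist l

/-- `Stutter p l l'`: the list `l'` arises from `l` by deleting entries and by repeating
the last entry read (initially `p`) any number of times. -/
inductive Stutter : Option ℕ → List ℕ → List ℕ → Prop
  | nil (p : Option ℕ) : Stutter p [] []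
  | keep {p : Option ℕ} {a : ℕ} {l l' : List ℕ} :
      Stutter (some a) l l' → Stutter p (a :: l) (a :: l')
  | dup {a : ℕ} {l l' : List ℕ} : Stutter (some a) l l' → Stutter (some a) l (a :: l')
  | drop {p : Option ℕ} {a : ℕ} {l l' : List ℕ} :
      Stutter (some a) l l' → Stutter p (a :: l) l'

theorem Stutter.to_nil (l : List ℕ) : ∀ p, Stutter p l [] := by
  induction l with
  | nil => exact fun p => .nil p
  | cons a l ih => exact fun p => .drop (ih _)

theorem Stutter.sublist_or {p : Option ℕ} {l l' : List ℕ} (h : Stutter p l l') :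
    ∀ w : List ℕ, w.IsChain (· ≠ ·) → w.Sublist l' →
      w.Sublist l ∨ ∃ a t, p = some a ∧ w = a :: t ∧ t.Sublist l := by
  induction h with
  | nil p => exact fun w _ hw => Or.inl hw
  | @keep p a l l' _ ih =>
    intro w hc hw
    left
    cases hw with
    | cons _ hw =>
      rcases ih w hc hw with h | ⟨b, t, hb, rfl, ht⟩
      · exact h.cons a
      · cases hb
        exact ht.cons_cons a
    | cons_cons _ hw =>
      rcases ih _ hc.tail hw with h | ⟨b, t, hb, rfl, ht⟩
      · exact h.cons_cons a
      · cases hb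
        simp at hc
  | @dup a l l' _ ih =>
    intro w hc hw
    cases hw with
    | cons _ hw => exact ih w hc hw
    | cons_cons _ hw =>
      rcases ih _ hc.tail hw with h | ⟨b, t, hb, rfl, ht⟩
      · exact Or.inr ⟨a, _, rfl, rfl, h⟩
      · cases hb
        simp at hc
  | @drop p a l l' _ ih =>
    intro w hc hw
    left
    rcases ih w hc hw with h | ⟨b, t, hb, rfl, ht⟩
    · exact h.cons a
    · cases hb
      exact ht.cons_cons a

theorem Stutter.avoidsABABA {l l' : List ℕ} (h : Stutter none l l') (hl : AvoidsABABA l) :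
    AvoidsABABA l' := by
  intro a b hab hw
  rcases h.sublist_or _ (by simp [hab, hab.symm]) hw with h | ⟨_, _, h, _⟩
  · exact hl a b hab h
  · cases h

theorem Stutter.append_getLast {l l' : List ℕ} (h : ∀ p, Stutter p l l') :
    ∀ (blk pre : List ℕ), pre.Sublist blk → ∀ p,
      Stutter p (blk ++ l) (pre ++ (blk.getLast?.toList ++ l'))
  | [], pre, hs, p => by
    cases hs
    exact h p
  | [b], pre, hs, p => by
    cases hs with
    | cons _ hs =>
      cases hs
      exact .drop (.dup (h _))
    | cons_cons _ hs =>
      cases hs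
      exact .keep (.dup (h _))
  | b :: c :: blk, pre, hs, p => by
    cases hs with
    | cons _ hs =>
      simpa using Stutter.drop (Stutter.append_getLast h (c :: blk) _ hs (some b))
    | cons_cons _ hs =>
      simpa using Stutter.keep (Stutter.append_getLast h (c :: blk) _ hs (some b))

theorem List.Sublist.of_append_of_head_notMem {α : Type*} {a : α} {l r s : List α}
    (h : (a :: l).Sublist (r ++ s)) (ha : a ∉ r) : (a :: l).Sublist s := by
  induction r with
  | nil => exact h
  | cons b r ih =>
    simp only [List.mem_cons, not_or] at ha
    cases h with
    | cons _ h => exact ih h ha.2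
    | cons_cons _ h => exact absurd rfl ha.1

theorem List.Sublist.of_append_of_last_notMem {α : Type*} {a : α} {l r s : List α}
    (h : (l ++ [a]).Sublist (r ++ s)) (ha : a ∉ s) : (l ++ [a]).Sublist r := by
  have h' := h.reverse
  simp only [List.reverse_append, List.reverse_cons, List.reverse_nil, List.nil_append,
    List.singleton_append] at h'
  have := (h'.of_append_of_head_notMem (by simpa using ha)).reverse
  simpa using this

/-! ### Symbols of token lists -/

@[simp] theorem symsOf_append (l r : List Tok) : symsOf (l ++ r) = symsOf l ++ symsOf r := by
  induction l with
  | nil => rfl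
  | cons t l ih => cases t <;> simp [symsOf, ih]

@[simp] theorem symsOf_map_sym (l : List ℕ) : symsOf (l.map Tok.sym) = l := by
  induction l with
  | nil => rfl
  | cons t l ih => simp [symsOf, ih]

theorem symsOf_takeBlock (l : List Tok) :
    symsOf l = (takeBlock l).1 ++ symsOf (takeBlock l).2 := by
  induction l with
  | nil => rfl
  | cons t l ih => cases t <;> simp [symsOf, takeBlock, ih]

theorem symsOf_split2 (l : List Tok) : symsOf (split2 l) = symsOf l := by
  induction l using split2.induct with
  | case1 a b r ih => simp [split2, symsOf, ih]
  | case2 t r h ih =>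
    rw [split2]
    · cases t <;> simp [symsOf, ih]
    · exact h
  | case3 => rfl

theorem loc_ne_glob (i a b : ℕ) : loc i a ≠ glob b := by
  unfold loc glob
  omega

theorem glob_inj {a b : ℕ} : glob a = glob b ↔ a = b := by
  unfold glob
  omega

theorem loc_inj {i j a b : ℕ} : loc i a = loc j b ↔ i = j ∧ a = b := by
  unfold loc
  rw [Nat.mul_right_inj (by norm_num), Nat.pair_eq_pair]

theorem exists_eq_glob_or_loc (x : ℕ) : (∃ a, x = glob a) ∨ ∃ i a, x = loc i a := by
  rcases Nat.even_or_odd' x with ⟨c, h | h⟩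
  · exact Or.inr ⟨c.unpair.1, c.unpair.2, by simp [loc, h]⟩
  · exact Or.inl ⟨c, h⟩

/-- Partial inverse of `glob`. -/
def unglob (x : ℕ) : Option ℕ := if x % 2 = 1 then some (x / 2) else none

/-- Partial inverse of `loc i`. -/
def unloc (i x : ℕ) : Option ℕ :=
  if x % 2 = 0 ∧ (Nat.unpair (x / 2)).1 = i then some (Nat.unpair (x / 2)).2 else none

@[simp] theorem unglob_glob (a : ℕ) : unglob (glob a) = some a := by
  unfold unglob glob
  rw [if_pos (by omega)]
  congr 1
  omega

@[simp] theorem unglob_loc (i a : ℕ) : unglob (loc i a) = none := by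
  unfold unglob loc
  rw [if_neg (by omega)]

@[simp] theorem unloc_glob (i a : ℕ) : unloc i (glob a) = none := by
  unfold unloc glob
  rw [if_neg (by omega)]

@[simp] theorem unloc_loc_self (i a : ℕ) : unloc i (loc i a) = some a := by
  simp [unloc, loc]

theorem unloc_loc_of_ne {i j : ℕ} (h : j ≠ i) (a : ℕ) : unloc i (loc j a) = none := by
  simp [unloc, loc, h]

/-! ### Blocks of first occurrences -/

/-- Reading the token list, starting inside a block iff the flag is set and having
already seen the symbols in the given set, blocks are well-parenthesized, not nested, and
contain only symbols not seen before. -/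
def BlocksFresh : Bool → Set ℕ → List Tok → Prop
  | b, _, [] => b = false
  | b, s, Tok.sym a :: r => (b = true → a ∉ s) ∧ BlocksFresh b (insert a s) r
  | b, s, Tok.op :: r => b = false ∧ BlocksFresh true s r
  | b, s, Tok.cl :: r => b = true ∧ BlocksFresh false s r

theorem BlocksFresh.append {l r : List Tok} : ∀ {b : Bool} {s : Set ℕ},
    BlocksFresh b s l → BlocksFresh false (s ∪ {x | x ∈ symsOf l}) r →
      BlocksFresh b s (l ++ r) := by
  induction l with
  | nil =>
    intro b s hl hr
    simp only [BlocksFresh] at hl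
    simpa [hl, symsOf] using hr
  | cons t l ih =>
    intro b s hl hr
    cases t with
    | sym a =>
      refine ⟨hl.1, ih hl.2 ?_⟩
      convert hr using 1
      ext x
      simp only [symsOf, List.mem_cons, Set.mem_union, Set.mem_insert_iff, Set.mem_ofPred_eq]
      tauto
    | op => exact ⟨hl.1, ih hl.2 hr⟩
    | cl => exact ⟨hl.1, ih hl.2 hr⟩

theorem BlocksFresh.map_sym (l : List ℕ) :
    ∀ s : Set ℕ, BlocksFresh false s (l.map Tok.sym) := by
  induction l with
  | nil => exact fun s => rfl
  | cons a l ih => exact fun s => ⟨by simp, ih _⟩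

theorem BlocksFresh.block {l : List ℕ} : ∀ {s : Set ℕ}, l.Nodup → (∀ x ∈ l, x ∉ s) →
    BlocksFresh true s (l.map Tok.sym ++ [Tok.cl]) := by
  induction l with
  | nil => exact fun _ _ => ⟨rfl, rfl⟩
  | cons a l ih =>
    intro s hn hs
    rw [List.nodup_cons] at hn
    refine ⟨fun _ => hs a (by simp), ih hn.2 fun x hx => ?_⟩
    rintro (rfl | h)
    · exact hn.1 hx
    · exact hs x (by simp [hx]) h

theorem BlocksFresh.takeBlock {l : List Tok} : ∀ {s : Set ℕ}, BlocksFresh true s l →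
    (takeBlock l).1.Nodup ∧ (∀ x ∈ (takeBlock l).1, x ∉ s) ∧
      BlocksFresh false (s ∪ {x | x ∈ (takeBlock l).1}) (takeBlock l).2 := by
  induction l with
  | nil => exact fun h => by simp [BlocksFresh] at h
  | cons t l ih =>
    intro s h
    cases t with
    | sym a =>
      obtain ⟨hn, hs, hf⟩ := ih h.2
      refine ⟨List.nodup_cons.2 ⟨fun ha => hs a ha (by simp), hn⟩, ?_, ?_⟩
      · rintro x hx hxs
        rcases List.mem_cons.1 hx with rfl | hx
        · exact h.1 rfl hxs
        · exact hs x hx (by simp [hxs])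
      · rw [_root_.takeBlock]
        convert hf using 1
        ext x
        simp only [List.mem_cons, Set.mem_union, Set.mem_insert_iff,
          Set.mem_ofPred_eq]
        tauto
    | op => exact absurd h.1 (by simp)
    | cl => exact ⟨by simp [_root_.takeBlock], by simp [_root_.takeBlock],
        by simpa [_root_.takeBlock] using h.2⟩

theorem BlocksFresh.split2 {l : List Tok} : ∀ {b : Bool} {s : Set ℕ},
    BlocksFresh b s l → BlocksFresh b s (split2 l) := by
  induction l using split2.induct with
  | case1 a c r ih =>
    intro b s h
    simp only [BlocksFresh, _root_.split2] at h ⊢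
    have := ih h.2.2.2.2
    tauto
  | case2 t r h ih =>
    intro b s hf
    rw [_root_.split2]
    · cases t <;> exact ⟨hf.1, ih hf.2⟩
    · exact h
  | case3 => exact fun h => h

/-! ### The modified copies of `A` -/

section copies

variable (i : ℕ)

theorem mem_symsOf_copyIns {A : List Tok} : ∀ {ins : List ℕ} {p : Option ℕ} {x : ℕ},
    x ∈ symsOf (copyIns i A ins (p.map (loc i))) → (∃ a, x = loc i a) ∨ ∃ b ∈ ins, x = glob b := by
  induction A with
  | nil => simp [copyIns, symsOf]
  | cons t A ih =>
    intro ins p x hx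
    cases t with
    | sym a =>
      simp only [copyIns, symsOf, List.mem_cons] at hx
      rcases hx with rfl | hx
      · exact Or.inl ⟨a, rfl⟩
      · exact ih (p := some a) hx
    | op => exact ih (by simpa [copyIns, symsOf] using hx)
    | cl =>
      rcases ins with _ | ⟨b, ins⟩
      · exact ih (p := p) (by simpa [copyIns, symsOf] using hx)
      · rcases p with _ | q
        · exact ih (p := none) (by simpa [copyIns, symsOf] using hx)
        · simp only [Option.map_some, copyIns, symsOf, List.mem_cons] at hx
          rcases hx with rfl | rfl | hx
          · exact Or.inr ⟨b, by simp, rfl⟩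
          · exact Or.inl ⟨q, rfl⟩
          · rcases ih (p := some q) hx with h | ⟨c, hc, rfl⟩
            · exact Or.inl h
            · exact Or.inr ⟨c, by simp [hc], rfl⟩

theorem filterMap_unglob_copyIns (A : List Tok) : ∀ (ins : List ℕ) (p : Option ℕ),
    ((symsOf (copyIns i A ins (p.map (loc i)))).filterMap unglob).Sublist ins := by
  induction A with
  | nil => simp [copyIns, symsOf]
  | cons t A ih =>
    intro ins p
    cases t with
    | sym a => simpa [copyIns, symsOf] using ih ins (some a)
    | op => simpa [copyIns, symsOf] using ih ins p
    | cl =>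
      rcases ins with _ | ⟨b, ins⟩
      · simpa [copyIns, symsOf] using ih [] p
      · rcases p with _ | q
        · simpa [copyIns, symsOf] using ih (b :: ins) none
        · simpa [copyIns, symsOf] using ih ins (some q)

theorem stutter_copyIns (A : List Tok) : ∀ (ins : List ℕ) (p : Option ℕ),
    Stutter p (symsOf A)
      ((symsOf (copyIns i A ins (p.map (loc i)))).filterMap (unloc i)) := by
  induction A with
  | nil => exact fun ins p => by simpa [copyIns, symsOf] using Stutter.nil p
  | cons t A ih =>
    intro ins p
    cases t with
    | sym a => simpa [copyIns, symsOf] using Stutter.keep (p := p) (ih ins (some a))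
    | op => simpa [copyIns, symsOf] using ih ins p
    | cl =>
      rcases ins with _ | ⟨b, ins⟩
      · simpa [copyIns, symsOf] using ih [] p
      · rcases p with _ | q
        · simpa [copyIns, symsOf] using ih (b :: ins) none
        · simpa [copyIns, symsOf] using Stutter.dup (ih ins (some q))

theorem BlocksFresh.copyIns {A : List Tok} : ∀ {b : Bool} {s t : Set ℕ} {ins : List ℕ}
    {p : Option ℕ}, BlocksFresh b s A → (∀ x, loc i x ∈ t → x ∈ s) →
      (∀ g ∈ ins, glob g ∉ t) → ins.Nodup → (∀ q, p = some q → q ∈ s) →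
      BlocksFresh b t (copyIns i A ins (p.map (loc i))) := by
  induction A with
  | nil => exact fun h _ _ _ _ => h
  | cons u A ih =>
    intro b s t ins p h hloc hglob hn hp
    cases u with
    | sym a =>
      refine ⟨fun hb ha => h.1 hb (hloc a ha), ih (p := some a) h.2 ?_ ?_ hn ?_⟩
      · rintro x (hx | hx)
        · exact Or.inl (loc_inj.1 hx).2
        · exact Or.inr (hloc x hx)
      · rintro g hg (hx | hx)
        · exact loc_ne_glob _ _ _ hx.symm
        · exact hglob g hg hx
      · rintro q ⟨⟩
        exact Or.inl rfl
    | op => exact ⟨h.1, ih h.2 hloc hglob hn hp⟩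
    | cl =>
      rcases ins with _ | ⟨c, ins⟩
      · simpa [_root_.copyIns, BlocksFresh] using ⟨h.1, ih h.2 hloc hglob hn hp⟩
      · rcases p with _ | q
        · exact ⟨h.1, ih (p := none) h.2 hloc hglob hn hp⟩
        · rw [List.nodup_cons] at hn
          refine ⟨fun _ => hglob c (by simp), h.1, by simp, ih (p := some q) h.2 ?_ ?_ hn.2 hp⟩
          · rintro x (hx | hx | hx)
            · rw [(loc_inj.1 hx).2]
              exact hp q rfl
            · exact absurd hx (loc_ne_glob _ _ _)
            · exact hloc x hx
          · rintro g hg (hx | hx | hx)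
            · exact loc_ne_glob _ _ _ hx.symm
            · rw [glob_inj] at hx
              exact hn.1 (hx ▸ hg)
            · exact hglob g (by simp [hg]) hx

theorem symsOf_copyA (A : List Tok) (blk : List ℕ) :
    symsOf (copyA i A blk) =
      symsOf (copyIns i A blk none) ++ blk.getLast?.toList.map glob := by
  unfold copyA
  cases blk.getLast? <;> simp [symsOf]

theorem mem_symsOf_copyA {A : List Tok} {blk : List ℕ} {x : ℕ}
    (hx : x ∈ symsOf (copyA i A blk)) : (∃ a, x = loc i a) ∨ ∃ b ∈ blk, x = glob b := by
  rw [symsOf_copyA, List.mem_append] at hx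
  rcases hx with hx | hx
  · exact mem_symsOf_copyIns i (p := none) hx
  · obtain ⟨b, hb, rfl⟩ := List.mem_map.1 hx
    exact Or.inr ⟨b, List.mem_of_getLast? (by simpa using hb), rfl⟩

theorem loc_notMem_copyA {A : List Tok} {blk : List ℕ} {j a : ℕ} (h : j ≠ i) :
    loc j a ∉ symsOf (copyA i A blk) := by
  intro hx
  rcases mem_symsOf_copyA i hx with ⟨b, hb⟩ | ⟨b, _, hb⟩
  · exact h (loc_inj.1 hb).1
  · exact loc_ne_glob _ _ _ hb

theorem mem_block_of_glob_mem_copyA {A : List Tok} {blk : List ℕ} {g : ℕ}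
    (hx : glob g ∈ symsOf (copyA i A blk)) : g ∈ blk := by
  rcases mem_symsOf_copyA i hx with ⟨b, hb⟩ | ⟨b, hmem, hb⟩
  · exact absurd hb.symm (loc_ne_glob _ _ _)
  · rwa [glob_inj.1 hb]

theorem filterMap_unloc_copyA_of_ne {A : List Tok} {blk : List ℕ} {j : ℕ} (h : i ≠ j) :
    (symsOf (copyA i A blk)).filterMap (unloc j) = [] := by
  rw [List.filterMap_eq_nil_iff]
  intro x hx
  rcases mem_symsOf_copyA i hx with ⟨b, rfl⟩ | ⟨b, _, rfl⟩
  · exact unloc_loc_of_ne h b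
  · simp

theorem BlocksFresh.copyA {A : List Tok} {blk : List ℕ} {t : Set ℕ}
    (h : BlocksFresh false ∅ A) (hloc : ∀ x, loc i x ∉ t) (hglob : ∀ g ∈ blk, glob g ∉ t)
    (hn : blk.Nodup) : BlocksFresh false t (copyA i A blk) := by
  refine BlocksFresh.append (BlocksFresh.copyIns i (p := none) h
    (fun x hx => absurd hx (hloc x)) hglob hn (by simp)) ?_
  cases blk.getLast? <;> simp [BlocksFresh]

end copies

/-! ### The shuffle -/

section shuffle

variable {A : List Tok}

theorem le_of_loc_mem_bulletAux (i : ℕ) (B : List Tok) {j a : ℕ} :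
    loc j a ∈ symsOf (bulletAux A i B) → i ≤ j := by
  induction i, B using bulletAux.induct with
  | case1 i => simp [bulletAux, symsOf]
  | case2 i r ih =>
    intro h
    rw [bulletAux, symsOf_append, List.mem_append] at h
    rcases h with h | h
    · by_contra hij
      exact loc_notMem_copyA i (by omega) h
    · have := ih h
      omega
  | case3 i b r ih =>
    intro h
    rw [bulletAux] at h
    rcases List.mem_cons.1 h with h | h
    · exact absurd h (loc_ne_glob _ _ _)
    · exact ih h
  | case4 i r ih =>
    rw [bulletAux]
    exact ih

theorem filterMap_unloc_bulletAux_of_lt {i j : ℕ} (h : j < i) (B : List Tok) :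
    (symsOf (bulletAux A i B)).filterMap (unloc j) = [] := by
  rw [List.filterMap_eq_nil_iff]
  intro x hx
  rcases exists_eq_glob_or_loc x with ⟨a, rfl⟩ | ⟨k, a, rfl⟩
  · simp
  · have := le_of_loc_mem_bulletAux i B hx
    exact unloc_loc_of_ne (by omega) a

theorem stutter_unglob_bulletAux (i : ℕ) (B : List Tok) : ∀ p,
    Stutter p (symsOf B) ((symsOf (bulletAux A i B)).filterMap unglob) := by
  induction i, B using bulletAux.induct with
  | case1 i => exact fun p => by simpa [bulletAux, symsOf] using Stutter.nil p
  | case2 i r ih =>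
    intro p
    have key := Stutter.append_getLast ih (takeBlock r).1 _
      (filterMap_unglob_copyIns i A (takeBlock r).1 none) p
    have hmap : ∀ l : List ℕ, (l.map glob).filterMap unglob = l := by
      intro l
      simp [List.filterMap_map]
    rw [bulletAux, symsOf_append, symsOf_copyA, List.filterMap_append, List.filterMap_append,
      hmap, List.append_assoc]
    simpa [symsOf, symsOf_takeBlock r] using key
  | case3 i b r ih =>
    intro p
    simpa [bulletAux, symsOf] using Stutter.keep (p := p) (ih (some b))
  | case4 i r ih => simpa [bulletAux, symsOf] using ih

theorem stutter_unloc_bulletAux (j i : ℕ) (B : List Tok) :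
    Stutter none (symsOf A) ((symsOf (bulletAux A i B)).filterMap (unloc j)) := by
  induction i, B using bulletAux.induct with
  | case1 i => simpa [bulletAux, symsOf] using Stutter.to_nil _ none
  | case2 i r ih =>
    rw [bulletAux, symsOf_append, List.filterMap_append]
    by_cases hij : i = j
    · subst hij
      rw [filterMap_unloc_bulletAux_of_lt (Nat.lt_succ_self i), symsOf_copyA]
      simpa [List.filterMap_map, Function.comp_def] using
        stutter_copyIns i A (takeBlock r).1 none
    · rw [filterMap_unloc_copyA_of_ne i hij]
      exact ih
  | case3 i b r ih => simpa [bulletAux, symsOf] using ih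
  | case4 i r ih => simpa [bulletAux, symsOf] using ih

theorem not_sublist_loc_loc {j k x y : ℕ} (hjk : j ≠ k) (i : ℕ) (B : List Tok) :
    ¬ [loc j x, loc k y, loc j x].Sublist (symsOf (bulletAux A i B)) := by
  induction i, B using bulletAux.induct with
  | case1 i => simp [bulletAux, symsOf]
  | case2 i r ih =>
    intro h
    rw [bulletAux, symsOf_append] at h
    by_cases hij : j = i
    · have h' := List.Sublist.of_append_of_last_notMem (l := [loc j x, loc k y]) h
        (fun hm => by have := le_of_loc_mem_bulletAux _ _ hm; omega)
      exact loc_notMem_copyA (a := y) i (by omega : k ≠ i) (h'.subset (by simp))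
    · exact ih (h.of_append_of_head_notMem (loc_notMem_copyA i hij))
  | case3 i b r ih =>
    intro h
    rw [bulletAux] at h
    exact ih (List.Sublist.of_append_of_head_notMem (r := [glob b]) h
      (by simpa using loc_ne_glob _ _ _))
  | case4 i r ih => simpa [bulletAux, symsOf] using ih

theorem not_sublist_glob_loc {g j x : ℕ} (i : ℕ) (B : List Tok) : ∀ {s : Set ℕ},
    BlocksFresh false s B →
    (g ∈ s → ¬ [loc j x, glob g, loc j x].Sublist (symsOf (bulletAux A i B))) ∧
      ¬ [glob g, loc j x, glob g, loc j x].Sublist (symsOf (bulletAux A i B)) := by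
  induction i, B using bulletAux.induct with
  | case1 i => simp [bulletAux, symsOf]
  | case2 i r ih =>
    intro s hB
    obtain ⟨hn, hs, hr⟩ := hB.2.takeBlock
    obtain ⟨ih₁, ih₂⟩ := ih hr
    rw [bulletAux, symsOf_append]
    by_cases hji : j = i
    · subst hji
      have hx : loc j x ∉ symsOf (bulletAux A (j + 1) (takeBlock r).2) := fun hm => by
        have := le_of_loc_mem_bulletAux _ _ hm
        omega
      refine ⟨fun hg h => ?_, fun h => ?_⟩
      · have h' := List.Sublist.of_append_of_last_notMem (l := [loc j x, glob g]) h hx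
        exact hs g (mem_block_of_glob_mem_copyA j (h'.subset (by simp))) hg
      · have h' := List.Sublist.of_append_of_last_notMem
          (l := [glob g, loc j x, glob g]) h hx
        rw [symsOf_copyA] at h'
        have h'' := List.Sublist.of_append_of_last_notMem
          (l := [glob g, loc j x, glob g]) h' (by
            rw [List.mem_map]
            rintro ⟨b, _, hb⟩
            exact loc_ne_glob _ _ _ hb.symm)
        have h3 := (h''.filterMap unglob).trans (filterMap_unglob_copyIns j A _ none)
        have h4 := hn.sublist h3
        simp at h4
    · have hx := loc_notMem_copyA (A := A) (blk := (takeBlock r).1) (a := x) i hji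
      refine ⟨fun hg h => ih₁ (Or.inl hg) (h.of_append_of_head_notMem hx), fun h => ?_⟩
      by_cases hg : glob g ∈ symsOf (copyA i A (takeBlock r).1)
      · exact ih₁ (Or.inr (mem_block_of_glob_mem_copyA i hg))
          (((List.sublist_cons_self _ _).trans h).of_append_of_head_notMem hx)
      · exact ih₂ (h.of_append_of_head_notMem hg)
  | case3 i b r ih =>
    intro s hB
    obtain ⟨ih₁, ih₂⟩ := ih hB.2
    rw [bulletAux, symsOf]
    refine ⟨fun hg h => ?_, fun h => ?_⟩
    · exact ih₁ (Or.inr hg) (List.Sublist.of_append_of_head_notMem (r := [glob b]) h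
        (by simpa using loc_ne_glob _ _ _))
    · by_cases hbg : g = b
      · exact ih₁ (Or.inl hbg) (List.cons_sublist_cons'.1 h |>.elim
          (fun h => (List.sublist_cons_self _ _).trans h) And.right)
      · exact ih₂ (List.Sublist.of_append_of_head_notMem (r := [glob b]) h
          (by simpa [glob_inj] using hbg))
  | case4 i r ih => exact fun hB => absurd hB.1 (by simp)

theorem BlocksFresh.bulletAux (hA : BlocksFresh false ∅ A) (i : ℕ) (B : List Tok) :
    ∀ {s t : Set ℕ}, BlocksFresh false s B → (∀ g, glob g ∈ t → g ∈ s) →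
      (∀ j x, loc j x ∈ t → j < i) → BlocksFresh false t (bulletAux A i B) := by
  induction i, B using bulletAux.induct with
  | case1 i => simp [_root_.bulletAux, BlocksFresh]
  | case2 i r ih =>
    intro s t hB hglob hloc
    obtain ⟨hn, hs, hr⟩ := hB.2.takeBlock
    rw [_root_.bulletAux]
    refine BlocksFresh.append (BlocksFresh.copyA i hA
      (fun x hx => lt_irrefl _ (hloc i x hx)) (fun g hg ht => hs g hg (hglob g ht)) hn)
      (ih hr ?_ ?_)
    · rintro g (hg | hg)
      · exact Or.inl (hglob g hg)
      · exact Or.inr (mem_block_of_glob_mem_copyA i hg)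
    · rintro j x (hx | hx)
      · exact (hloc j x hx).trans (Nat.lt_succ_self i)
      · by_contra hji
        exact loc_notMem_copyA i (by omega) hx
  | case3 i b r ih =>
    intro s t hB hglob hloc
    rw [_root_.bulletAux]
    refine ⟨by simp, ih hB.2 ?_ ?_⟩
    · rintro g (hg | hg)
      · exact Or.inl (glob_inj.1 hg)
      · exact Or.inr (hglob g hg)
    · rintro j x (hx | hx)
      · exact absurd hx (loc_ne_glob _ _ _)
      · exact hloc j x hx
  | case4 i r ih => exact fun hB => absurd hB.1 (by simp)

theorem AvoidsABABA.bullet {B : List Tok} (hA : AvoidsABABA (symsOf A))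
    (hB : AvoidsABABA (symsOf B)) (hfresh : BlocksFresh false ∅ B) :
    AvoidsABABA (symsOf (bullet A B)) := by
  intro a b hab h
  rw [_root_.bullet] at h
  rcases exists_eq_glob_or_loc a with ⟨x, rfl⟩ | ⟨j, x, rfl⟩ <;>
    rcases exists_eq_glob_or_loc b with ⟨y, rfl⟩ | ⟨k, y, rfl⟩
  · refine (stutter_unglob_bulletAux (A := A) 0 B none).avoidsABABA hB x y
      (fun hxy => hab (hxy ▸ rfl)) ?_
    simpa using h.filterMap unglob
  · exact (not_sublist_glob_loc 0 B hfresh).2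
      ((List.sublist_append_left [glob x, loc k y, glob x, loc k y] [glob x]).trans h)
  · exact (not_sublist_glob_loc 0 B hfresh).2 ((List.sublist_cons_self _ _).trans h)
  · by_cases hjk : j = k
    · subst hjk
      refine (stutter_unloc_bulletAux j 0 B).avoidsABABA hA x y
        (fun hxy => hab (hxy ▸ rfl)) ?_
      simpa using h.filterMap (unloc j)
    · exact not_sublist_loc_loc hjk 0 B
        ((List.sublist_append_left [loc j x, loc k y, loc j x] [loc k y, loc j x]).trans h)

end shuffle

/-! ### The Hart–Sharir sequences -/

theorem blocksFresh_S1 (m : ℕ) : BlocksFresh false ∅ (S1 m) := by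
  have h := BlocksFresh.append (BlocksFresh.block (s := ∅) (l := List.range' 1 m)
    List.nodup_range' (by simp)) (BlocksFresh.map_sym
      ((List.range' 1 (m - 1)).reverse ++ List.range' 2 (m - 1)) _)
  exact ⟨rfl, by simpa using h⟩

theorem avoidsABABA_S1 (m : ℕ) : AvoidsABABA (symsOf (S1 m)) := by
  intro a b hab h
  have hS : symsOf (S1 m) = List.range' 1 m ++
      ((List.range' 1 (m - 1)).reverse ++ List.range' 2 (m - 1)) := by
    simp [S1, symsOf, -List.map_reverse]
  rw [hS, List.sublist_append_iff] at h
  obtain ⟨u, w, huw, hu, hw⟩ := h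
  obtain ⟨v, w, rfl, hv, hw⟩ := List.sublist_append_iff.1 hw
  have pu := List.Pairwise.sublist hu (List.pairwise_lt_range' (s := 1) (n := m))
  have pv := List.Pairwise.sublist hv.reverse
    (by simpa using List.pairwise_lt_range' (s := 1) (n := m - 1))
  have pw := List.Pairwise.sublist hw (List.pairwise_lt_range' (s := 2) (n := m - 1))
  rw [List.pairwise_reverse] at pv
  clear hu hv hw hS
  rcases u with _ | ⟨u₁, _ | ⟨u₂, _ | ⟨u₃, u⟩⟩⟩ <;>
    rcases v with _ | ⟨v₁, _ | ⟨v₂, _ | ⟨v₃, v⟩⟩⟩ <;>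
      rcases w with _ | ⟨w₁, _ | ⟨w₂, _ | ⟨w₃, w⟩⟩⟩ <;>
        simp at huw pu pv pw <;> omega

theorem HS_blocksFresh_and_avoidsABABA (k m : ℕ) :
    BlocksFresh false ∅ (HS k m) ∧ AvoidsABABA (symsOf (HS k m)) := by
  induction k, m using HS.induct with
  | case1 m => simp [HS, BlocksFresh, AvoidsABABA, symsOf]
  | case2 m =>
    rw [HS]
    exact ⟨blocksFresh_S1 m, avoidsABABA_S1 m⟩
  | case3 k => simp [HS, BlocksFresh, AvoidsABABA, symsOf]
  | case4 k ih =>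
    rw [HS, symsOf_split2]
    exact ⟨ih.1.split2, ih.2⟩
  | case5 k m ihA ihB =>
    rw [HS]
    exact ⟨BlocksFresh.bulletAux ihA.1 0 _ ihB.1 (by simp) (by simp),
      AvoidsABABA.bullet ihA.2 ihB.2 ihB.1⟩

/-- The Hart–Sharir sequences avoid `ababa` (Hart–Sharir): for all `k, m ≥ 1`,
`S_k(m)` contains no (not necessarily contiguous) subsequence `a b a b a` with
`a ≠ b`. -/
theorem HS_avoids_ababa (k m : ℕ) (hk : 1 ≤ k) (hm : 1 ≤ m) :
    ¬ ∃ a b : ℕ, a ≠ b ∧ [a, b, a, b, a].Sublist (symsOf (HS k m)) := by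
  rintro ⟨a, b, hab, h⟩
  exact (HS_blocksFresh_and_avoidsABABA k m).2 a b hab h
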